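/- Let μ be an isotropic log-concave probability measure on ℝ^n with density f. Then for every convex body A ⊂ ℝ^n, μ(A) ≤ w_A, where w_A is the minimal width of A: w_A = min over unit vectors ξ of (h_A(ξ) + h_A(−ξ)), with h_A(ξ) = max{⟨x,ξ⟩ : x ∈ A} the support function of A. -/

import Mathlib

open MeasureTheory Metric Filter Set
open scoped RealInnerProductSpace

noncomputable section

abbrev Euc (n : ℕ) := EuclideanSpace ℝ (Fin n)

/-- `f` is a log-concave (nonnegative) function on `ℝ^n`. -/
def IsLogConcaveFn {n : ℕ} (f : Euc n → ℝ) : Prop :=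
  (∀ x, 0 ≤ f x) ∧
  ∀ x y : Euc n, ∀ τ : ℝ, 0 ≤ τ → τ ≤ 1 →
    f x ^ τ * f y ^ (1 - τ) ≤ f (τ • x + (1 - τ) • y)

/-- A convex body: compact convex set with nonempty interior. -/
def IsConvexBody {n : ℕ} (A : Set (Euc n)) : Prop :=
  Convex ℝ A ∧ IsCompact A ∧ (interior A).Nonempty

/-- The support function `h_A(ξ) = sup {⟨x, ξ⟩ : x ∈ A}`. -/
def suppFn {n : ℕ} (A : Set (Euc n)) (ξ : Euc n) : ℝ :=
  sSup ((fun x => ⟪x, ξ⟫) '' A)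

/-- The minimal width `w_A = min_{‖ξ‖ = 1} (h_A(ξ) + h_A(-ξ))`. -/
def minWidth {n : ℕ} (A : Set (Euc n)) : ℝ :=
  sInf {w | ∃ ξ : Euc n, ‖ξ‖ = 1 ∧ w = suppFn A ξ + suppFn A (-ξ)}

open scoped ENNReal

/-- log-concavity for extended nonnegative functions -/
def LC {E : Type*} [AddCommGroup E] [Module ℝ E] (F : E → ℝ≥0∞) : Prop :=
  ∀ x y : E, ∀ a b : ℝ, 0 < a → 0 < b → a + b = 1 → F x ^ a * F y ^ b ≤ F (a • x + b • y)

/-- quasi-concavity -/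
def QC {E : Type*} [AddCommGroup E] [Module ℝ E] (F : E → ℝ≥0∞) : Prop :=
  ∀ t : ℝ≥0∞, Convex ℝ {x | t < F x}

lemma LC.qc {E : Type*} [AddCommGroup E] [Module ℝ E] {F : E → ℝ≥0∞} (h : LC F) : QC F := by
  intro t
  rw [convex_iff_forall_pos]
  intro x hx y hy a b ha hb hab
  simp only [mem_ofPred_eq] at *
  refine lt_of_lt_of_le (lt_min hx hy) (le_trans ?_ (h x y a b ha hb hab))
  calc min (F x) (F y) = min (F x) (F y) ^ a * min (F x) (F y) ^ b := by
        rw [← ENNReal.rpow_add_of_nonneg _ _ ha.le hb.le, hab, ENNReal.rpow_one]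
    _ ≤ _ := by gcongr; exacts [min_le_left _ _, min_le_right _ _]

lemma QC.aemeasurable {E : Type*} [NormedAddCommGroup E] [NormedSpace ℝ E] [MeasurableSpace E]
    [BorelSpace E] [FiniteDimensional ℝ E] {F : E → ℝ≥0∞} (h : QC F) (μ : Measure E)
    [μ.IsAddHaarMeasure] : AEMeasurable F μ := by
  apply NullMeasurable.aemeasurable
  apply measurable_of_Ioi (α := ℝ≥0∞) (δ := NullMeasurableSpace E μ)
  intro t
  exact (h t).nullMeasurableSet μ

lemma QC.measurable {F : ℝ → ℝ≥0∞} (h : QC F) : Measurable F :=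
  measurable_of_Ioi fun t => (h t).ordConnected.measurableSet

/-- one dimensional Brunn-Minkowski for convex sets -/
lemma bm_one {I J K : Set ℝ} (hI : Convex ℝ I) (hJ : Convex ℝ J) (hK : Convex ℝ K)
    (hIn : I.Nonempty) (hJn : J.Nonempty) {a b : ℝ} (ha : 0 < a) (hb : 0 < b)
    (h : ∀ x ∈ I, ∀ y ∈ J, a * x + b * y ∈ K) :
    ENNReal.ofReal a * volume I + ENNReal.ofReal b * volume J ≤ volume K := by
  have key : ∀ x ∈ I, ∀ x' ∈ I, ∀ y ∈ J, ∀ y' ∈ J, 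
      ENNReal.ofReal a * edist x x' + ENNReal.ofReal b * edist y y' ≤ volume K := by
    have main : ∀ x ∈ I, ∀ x' ∈ I, x ≤ x' → ∀ y ∈ J, ∀ y' ∈ J, y ≤ y' → 
      ENNReal.ofReal a * edist x x' + ENNReal.ofReal b * edist y y' ≤ volume K := by
      intro x hx x' hx' hxx y hy y' hy' hyy
      have hsub : Icc (a * x + b * y) (a * x' + b * y') ⊆ K :=
        hK.ordConnected.out (h x hx y hy) (h x' hx' y' hy')
      refine le_trans (le_of_eq ?_) (measure_mono hsub)
      rw [Real.volume_Icc, edist_comm x, edist_comm y, edist_dist, edist_dist, Real.dist_eq,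
        Real.dist_eq, abs_of_nonneg (by linarith), abs_of_nonneg (by linarith),
        ← ENNReal.ofReal_mul ha.le, ← ENNReal.ofReal_mul hb.le, ← ENNReal.ofReal_add]
      · congr 1; ring
      · exact mul_nonneg ha.le (by linarith)
      · exact mul_nonneg hb.le (by linarith)
    intro x hx x' hx' y hy y' hy'
    rcases le_total x x' with h1 | h1 <;> rcases le_total y y' with h2 | h2
    · exact main x hx x' hx' h1 y hy y' hy' h2
    · rw [edist_comm y]; exact main x hx x' hx' h1 y' hy' y hy h2
    · rw [edist_comm x]; exact main x' hx' x hx h1 y hy y' hy' h2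
    · rw [edist_comm x, edist_comm y]; exact main x' hx' x hx h1 y' hy' y hy h2
  have hd : ENNReal.ofReal a * ediam I + ENNReal.ofReal b * ediam J ≤ volume K := by
    obtain ⟨x0, hx0⟩ := hIn
    obtain ⟨y0, hy0⟩ := hJn
    have : Nonempty I := ⟨⟨x0, hx0⟩⟩
    have : Nonempty J := ⟨⟨y0, hy0⟩⟩
    have e1 : ediam I = ⨆ p : I × I, edist (p.1 : ℝ) p.2 := by
      rw [ediam]; simp [iSup_prod, iSup_subtype]
    have e2 : ediam J = ⨆ p : J × J, edist (p.1 : ℝ) p.2 := by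
      rw [ediam]; simp [iSup_prod, iSup_subtype]
    rw [e1, e2, ENNReal.mul_iSup, ENNReal.mul_iSup]
    rw [ENNReal.iSup_add]
    refine iSup_le fun p => ?_
    rw [ENNReal.add_iSup]
    exact iSup_le fun r => key _ p.1.2 _ p.2.2 _ r.1.2 _ r.2.2
  refine le_trans ?_ hd
  gcongr <;> exact Real.volume_le_diam _

lemma layer {F : ℝ → ℝ≥0∞} (hF : Measurable F) (h1 : ∀ x, F x ≤ 1) :
    ∫⁻ x, F x = ∫⁻ t in Ioi (0 : ℝ), volume {x | ENNReal.ofReal t < F x} := by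
  have hne : ∀ x, F x ≠ ∞ := fun x => ne_top_of_le_ne_top ENNReal.one_ne_top (h1 x)
  have := lintegral_eq_lintegral_meas_lt (volume : Measure ℝ) (f := fun x => (F x).toReal)
    (Eventually.of_forall fun x => ENNReal.toReal_nonneg) hF.ennreal_toReal.aemeasurable
  simp only [ENNReal.ofReal_toReal (hne _)] at this
  rw [this]
  refine setLIntegral_congr_fun measurableSet_Ioi fun t ht => ?_
  congr 1
  ext x
  simp only [mem_ofPred_eq]
  rw [ENNReal.ofReal_lt_iff_lt_toReal (le_of_lt ht) (hne x)]

lemma pl_norm {F G H : ℝ → ℝ≥0∞} (hF : QC F) (hG : QC G) (hH : QC H)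
    (hF1 : ∀ x, F x ≤ 1) (hG1 : ∀ x, G x ≤ 1) (hFs : ∀ r < 1, ∃ x, r < F x)
    (hGs : ∀ r < 1, ∃ x, r < G x) {a b : ℝ} (ha : 0 < a) (hb : 0 < b) (hab : a + b = 1)
    (h : ∀ x y, F x ^ a * G y ^ b ≤ H (a * x + b * y)) :
    ENNReal.ofReal a * (∫⁻ x, F x) + ENNReal.ofReal b * (∫⁻ x, G x) ≤ ∫⁻ x, H x := by
  have hH' : Measurable fun x => min (H x) 1 := hH.measurable.min measurable_const
  refine le_trans ?_ (lintegral_mono fun x => min_le_left (H x) 1)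
  rw [layer hF.measurable hF1, layer hG.measurable hG1, layer hH' fun x => min_le_right _ _]
  have mF : Measurable fun t : ℝ => volume {x | ENNReal.ofReal t < F x} := by
    apply Antitone.measurable
    intro s t hst
    refine measure_mono fun x hx => ?_
    exact lt_of_le_of_lt (ENNReal.ofReal_le_ofReal hst) hx
  rw [← lintegral_const_mul' _ _ ENNReal.ofReal_ne_top, 
    ← lintegral_const_mul' _ _ ENNReal.ofReal_ne_top, ← lintegral_add_left (mF.const_mul _)]
  refine lintegral_mono fun t => ?_
  simp only
  set r := ENNReal.ofReal t
  rcases lt_or_ge r 1 with hr | hr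
  · have : {x | r < min (H x) 1} = {x | r < H x} := by ext x; simp [hr]
    rw [this]
    refine bm_one (hF r) (hG r) (hH r) (hFs r hr) (hGs r hr) ha hb ?_
    intro x hx y hy
    simp only [mem_ofPred_eq] at *
    refine lt_of_lt_of_le ?_ (h x y)
    refine lt_of_lt_of_le (lt_min hx hy) ?_
    calc min (F x) (G y) = min (F x) (G y) ^ a * min (F x) (G y) ^ b := by
          rw [← ENNReal.rpow_add_of_nonneg _ _ ha.le hb.le, hab, ENNReal.rpow_one]
      _ ≤ _ := by gcongr; exacts [min_le_left _ _, min_le_right _ _]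
  · have e1 : {x | r < F x} = ∅ := by
      ext x; simpa using (hF1 x).trans hr
    have e2 : {x | r < G x} = ∅ := by
      ext x; simpa using (hG1 x).trans hr
    simp [e1, e2]

lemma amgm (X Y : ℝ≥0∞) {a b : ℝ} (ha : 0 < a) (hb : 0 < b) (hab : a + b = 1) :
    X ^ a * Y ^ b ≤ ENNReal.ofReal a * X + ENNReal.ofReal b * Y := by
  rcases eq_or_ne X ∞ with rfl | hX
  · simp [ENNReal.mul_top, ha]
  rcases eq_or_ne Y ∞ with rfl | hY
  · simp [ENNReal.mul_top, hb]
  have := Real.geom_mean_le_arith_mean2_weighted ha.le hb.le (p₁ := X.toReal) (p₂ := Y.toReal)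
    ENNReal.toReal_nonneg ENNReal.toReal_nonneg hab
  have h2 := ENNReal.ofReal_le_ofReal this
  rw [ENNReal.ofReal_mul (by positivity), ENNReal.ofReal_add (by positivity) (by positivity),
    ENNReal.ofReal_mul ha.le, ENNReal.ofReal_mul hb.le, ENNReal.ofReal_toReal hX,
    ENNReal.ofReal_toReal hY, ← ENNReal.ofReal_rpow_of_nonneg ENNReal.toReal_nonneg ha.le,
    ← ENNReal.ofReal_rpow_of_nonneg ENNReal.toReal_nonneg hb.le, ENNReal.ofReal_toReal hX,
    ENNReal.ofReal_toReal hY] at h2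
  exact h2

lemma QC.mul_const {F : ℝ → ℝ≥0∞} (hF : QC F) {c : ℝ≥0∞} (h0 : c ≠ 0) (h1 : c ≠ ∞) :
    QC fun x => F x * c := by
  intro t
  convert hF (t / c) using 3 with x
  exact (ENNReal.div_lt_iff (Or.inl h0) (Or.inl h1)).symm

lemma QC.min_const {F : ℝ → ℝ≥0∞} (hF : QC F) (c : ℝ≥0∞) : QC fun x => min (F x) c := by
  intro t
  rcases lt_or_ge t c with h | h
  · simpa [h] using hF t
  · simp [not_lt.2 h, convex_empty]

lemma sup_norm {F : ℝ → ℝ≥0∞} (hs0 : (⨆ x, F x) ≠ 0) (hs1 : (⨆ x, F x) ≠ ∞) :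
    (∀ x, F x * (⨆ x, F x)⁻¹ ≤ 1) ∧ ∀ r < 1, ∃ x, r < F x * (⨆ x, F x)⁻¹ := by
  constructor
  · intro x
    rw [← div_eq_mul_inv]
    exact ENNReal.div_le_of_le_mul (by simpa using le_iSup F x)
  · intro r hr
    have : r * (⨆ x, F x) < ⨆ x, F x := by
      conv_rhs => rw [← one_mul (⨆ x, F x)]
      exact ENNReal.mul_lt_mul_left hs0 hs1 hr
    obtain ⟨x, hx⟩ := lt_iSup_iff.1 this
    refine ⟨x, ?_⟩
    rw [← div_eq_mul_inv]
    exact (ENNReal.lt_div_iff_mul_lt (Or.inl hs0) (Or.inl hs1)).2 hx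

lemma pl_bdd {F G H : ℝ → ℝ≥0∞} (hF : QC F) (hG : QC G) (hH : QC H)
    (hFs : (⨆ x, F x) ≠ ∞) (hGs : (⨆ x, G x) ≠ ∞)
    {a b : ℝ} (ha : 0 < a) (hb : 0 < b) (hab : a + b = 1)
    (h : ∀ x y, F x ^ a * G y ^ b ≤ H (a * x + b * y)) :
    (∫⁻ x, F x) ^ a * (∫⁻ x, G x) ^ b ≤ ∫⁻ x, H x := by
  rcases eq_or_ne (⨆ x, F x) 0 with h0 | h0
  · have : ∀ x, F x = 0 := fun x => le_antisymm (h0 ▸ le_iSup F x) bot_le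
    simp [this, ha]
  rcases eq_or_ne (⨆ x, G x) 0 with h1 | h1
  · have : ∀ x, G x = 0 := fun x => le_antisymm (h1 ▸ le_iSup G x) bot_le
    simp [this, hb]
  obtain ⟨f1, f2⟩ := sup_norm h0 hFs
  obtain ⟨g1, g2⟩ := sup_norm h1 hGs
  set α := ⨆ x, F x
  set β := ⨆ x, G x
  have hα0 : α⁻¹ ≠ 0 := ENNReal.inv_ne_zero.2 hFs
  have hα1 : α⁻¹ ≠ ∞ := ENNReal.inv_ne_top.2 h0
  have hβ0 : β⁻¹ ≠ 0 := ENNReal.inv_ne_zero.2 hGs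
  have hβ1 : β⁻¹ ≠ ∞ := ENNReal.inv_ne_top.2 h1
  set γ := α⁻¹ ^ a * β⁻¹ ^ b with hγ
  have hγ0 : γ ≠ 0 := by
    rw [hγ, mul_ne_zero_iff]
    constructor
    · simp [ENNReal.rpow_eq_zero_iff, hα0, hα1, hFs, h0]
    · simp [ENNReal.rpow_eq_zero_iff, hα0, hα1, hGs, h1]
  have hγ1 : γ ≠ ∞ := ENNReal.mul_ne_top (ENNReal.rpow_ne_top_of_nonneg ha.le hα1)
    (ENNReal.rpow_ne_top_of_nonneg hb.le hβ1)
  have main := pl_norm (hF.mul_const hα0 hα1) (hG.mul_const hβ0 hβ1) (hH.mul_const hγ0 hγ1)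
    f1 g1 f2 g2 ha hb hab (by
      intro x y
      calc _ = (F x ^ a * G y ^ b) * γ := by
            rw [ENNReal.mul_rpow_of_nonneg _ _ ha.le, ENNReal.mul_rpow_of_nonneg _ _ hb.le, hγ]
            ring
        _ ≤ _ := by gcongr; exact h x y)
  have h3 := (amgm _ _ ha hb hab).trans main
  rw [lintegral_mul_const' _ _ hα1, lintegral_mul_const' _ _ hβ1, lintegral_mul_const' _ _ hγ1,
    ENNReal.mul_rpow_of_nonneg _ _ ha.le, ENNReal.mul_rpow_of_nonneg _ _ hb.le] at h3
  have h4 : (∫⁻ x, F x) ^ a * (∫⁻ x, G x) ^ b * γ ≤ (∫⁻ x, H x) * γ := by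
    refine le_trans (le_of_eq ?_) h3
    rw [hγ]; ring
  exact (ENNReal.mul_le_mul_iff_left hγ0 hγ1).1 h4

lemma tendsto_trunc {F : ℝ → ℝ≥0∞} (hF : Measurable F) :
    Tendsto (fun k : ℕ => ∫⁻ x, min (F x) k) atTop (nhds (∫⁻ x, F x)) := by
  refine lintegral_tendsto_of_tendsto_of_monotone 
    (fun k => (hF.min measurable_const).aemeasurable) ?_ ?_
  · refine Eventually.of_forall fun x k l hkl => ?_
    simp only
    gcongr
  · refine Eventually.of_forall fun x => ?_
    have := (tendsto_const_nhds (x := F x) (f := atTop)).min ENNReal.tendsto_nat_nhds_top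
    simpa using this

lemma pl_one {F G H : ℝ → ℝ≥0∞} (hF : QC F) (hG : QC G) (hH : QC H)
    {a b : ℝ} (ha : 0 < a) (hb : 0 < b) (hab : a + b = 1)
    (h : ∀ x y, F x ^ a * G y ^ b ≤ H (a * x + b * y)) :
    (∫⁻ x, F x) ^ a * (∫⁻ x, G x) ^ b ≤ ∫⁻ x, H x := by
  rcases eq_or_ne (∫⁻ x, F x) 0 with h0 | h0
  · simp [h0, ha]
  rcases eq_or_ne (∫⁻ x, G x) 0 with h1 | h1
  · simp [h1, hb]
  have t1 := ((ENNReal.continuous_rpow_const (y := a)).tendsto _).comp (tendsto_trunc hF.measurable)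
  have t2 := ((ENNReal.continuous_rpow_const (y := b)).tendsto _).comp (tendsto_trunc hG.measurable)
  have t3 := ENNReal.Tendsto.mul t1 (Or.inl (by simp [ENNReal.rpow_eq_zero_iff, h0, ha.le, ha])) t2
    (Or.inl (by simp [ENNReal.rpow_eq_zero_iff, h1, hb.le, hb]))
  refine le_of_tendsto' t3 fun k => ?_
  refine pl_bdd (hF.min_const k) (hG.min_const k) hH ?_ ?_ ha hb hab ?_
  · exact ne_top_of_le_ne_top (ENNReal.natCast_ne_top k) (iSup_le fun x => min_le_right _ _)
  · exact ne_top_of_le_ne_top (ENNReal.natCast_ne_top k) (iSup_le fun x => min_le_right _ _)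
  · intro x y
    refine le_trans ?_ (h x y)
    gcongr <;> exact min_le_left _ _

lemma lc_marg_one {W : Type*} [AddCommGroup W] [Module ℝ W] {G : W × ℝ → ℝ≥0∞} (h : LC G) :
    LC fun w => ∫⁻ s, G (w, s) := by
  have hq : ∀ w, QC fun s => G (w, s) := by
    intro w
    apply LC.qc
    intro s s' a b ha hb hab
    have := h (w, s) (w, s') a b ha hb hab
    simpa [← add_smul, hab] using this
  intro w w' a b ha hb hab
  refine pl_one (hq w) (hq w') (hq _) ha hb hab fun s s' => ?_
  exact h (w, s) (w', s') a b ha hb hab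

lemma lc_marg {V : Type*} [AddCommGroup V] [Module ℝ V] (m : ℕ) :
    ∀ F : V × (Fin m → ℝ) → ℝ≥0∞, LC F → LC fun v => ∫⁻ y, F (v, y) := by
  induction m with
  | zero =>
    intro F h v w a b ha hb hab
    have h0 := h (v, default) (w, default) a b ha hb hab
    simp only [volume_pi, Measure.pi_of_empty _ default, lintegral_dirac]
    convert h0 using 2
    ext1
    · simp
    · exact Subsingleton.elim _ _
  | succ m ih =>
    intro F h
    let e := (MeasurableEquiv.piFinSuccAbove (fun _ : Fin (m + 1) => ℝ) 0)
    have hadd : ∀ (a b : ℝ) (p q : ℝ × (Fin m → ℝ)),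
        e.symm (a • p + b • q) = a • e.symm p + b • e.symm q := by
      intro a b p q
      ext i
      refine Fin.cases ?_ (fun j => ?_) i <;> simp [e, MeasurableEquiv.piFinSuccAbove]
    have hF' : LC fun w : (V × (Fin m → ℝ)) × ℝ => F (w.1.1, e.symm (w.2, w.1.2)) := by
      intro x y a b ha hb hab
      refine (h (x.1.1, e.symm (x.2, x.1.2)) (y.1.1, e.symm (y.2, y.1.2)) a b ha hb hab).trans_eq ?_
      have := hadd a b (x.2, x.1.2) (y.2, y.1.2)
      simp only [Prod.smul_mk, Prod.mk_add_mk] at this ⊢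
      rw [← this]
      rfl
    have h2 := ih _ (lc_marg_one hF')
    convert h2 using 2 with v
    have hae : LC fun y => F (v, y) := by
      intro y y' a b ha hb hab
      have := h (v, y) (v, y') a b ha hb hab
      simpa [← add_smul, hab] using this
    have mp := (volume_preserving_piFinSuccAbove (fun _ : Fin (m + 1) => ℝ) 0).symm
    rw [← mp.lintegral_comp_emb (MeasurableEquiv.measurableEmbedding _), Measure.volume_eq_prod,
      lintegral_prod_symm]
    have := (hae.qc.aemeasurable volume).comp_quasiMeasurePreserving mp.quasiMeasurePreserving
    exact this

lemma lc_four {g : ℝ → ℝ≥0∞} (h : LC g) (a u v : ℝ) (huv : (0 ≤ u ∧ 0 ≤ v) ∨ (u ≤ 0 ∧ v ≤ 0)) :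
    g (a + u + v) * g a ≤ g (a + u) * g (a + v) := by
  rcases eq_or_ne u 0 with rfl | hu
  · simp [mul_comm]
  rcases eq_or_ne v 0 with rfl | hv
  · simp
  have huv0 : u + v ≠ 0 := by
    rcases huv with ⟨h1, h2⟩ | ⟨h1, h2⟩ <;> intro h3 <;> apply hu <;> linarith
  have hτ : 0 < u / (u + v) := by
    rcases huv with ⟨h1, h2⟩ | ⟨h1, h2⟩
    · exact div_pos (lt_of_le_of_ne h1 hu.symm) (lt_of_le_of_ne (by linarith) huv0.symm)
    · exact div_pos_of_neg_of_neg (lt_of_le_of_ne h1 hu) (lt_of_le_of_ne (by linarith) huv0)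
  have hσ : 0 < v / (u + v) := by
    rcases huv with ⟨h1, h2⟩ | ⟨h1, h2⟩
    · exact div_pos (lt_of_le_of_ne h2 hv.symm) (lt_of_le_of_ne (by linarith) huv0.symm)
    · exact div_pos_of_neg_of_neg (lt_of_le_of_ne h2 hv) (lt_of_le_of_ne (by linarith) huv0)
  have hs : u / (u + v) + v / (u + v) = 1 := by field_simp
  have h1 := h (a + u + v) a _ _ hτ hσ hs
  have h2 := h (a + u + v) a _ _ hσ hτ (by rw [add_comm]; exact hs)
  have e1 : (u / (u + v)) • (a + u + v) + (v / (u + v)) • a = a + u := by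
    simp only [smul_eq_mul]; field_simp; ring
  have e2 : (v / (u + v)) • (a + u + v) + (u / (u + v)) • a = a + v := by
    simp only [smul_eq_mul]; field_simp; ring
  rw [e1] at h1
  rw [e2] at h2
  refine le_trans (le_of_eq ?_) (mul_le_mul' h1 h2)
  set τ := u / (u + v)
  set σ := v / (u + v)
  set X := g (a + u + v)
  have hX : ∀ X : ℝ≥0∞, X = X ^ τ * X ^ σ := fun X => by
    rw [← ENNReal.rpow_add_of_nonneg _ _ hτ.le hσ.le, hs, ENNReal.rpow_one]
  conv_lhs => rw [hX X, hX (g a)]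
  ring

lemma hazard_right {g : ℝ → ℝ≥0∞} (h : LC g) {a s : ℝ} (has : a ≤ s) :
    g a * volume.withDensity g (Ioi s) ≤ g s * volume.withDensity g (Ioi a) := by
  have hm := h.qc.measurable
  rw [withDensity_apply _ measurableSet_Ioi, withDensity_apply _ measurableSet_Ioi,
    ← lintegral_const_mul _ hm, ← lintegral_const_mul _ hm]
  rw [← lintegral_indicator measurableSet_Ioi, ← lintegral_indicator measurableSet_Ioi,
    ← lintegral_add_right_eq_self _ (s - a)]
  refine lintegral_mono fun t => ?_
  by_cases ht : a < t
  · have h1 : t + (s - a) ∈ Ioi s := by simp only [mem_Ioi]; linarith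
    rw [indicator_of_mem h1, indicator_of_mem (show t ∈ Ioi a from ht)]
    have := lc_four h a (s - a) (t - a) (Or.inl ⟨by linarith, by linarith⟩)
    rw [show a + (s - a) + (t - a) = t + (s - a) by ring, show a + (s - a) = s by ring,
      show a + (t - a) = t by ring] at this
    rw [mul_comm]; exact this
  · have h1 : t + (s - a) ∉ Ioi s := by simp only [mem_Ioi]; linarith
    rw [indicator_of_notMem h1]; exact bot_le

lemma hazard_left {g : ℝ → ℝ≥0∞} (h : LC g) {a s : ℝ} (has : s ≤ a) :
    g a * volume.withDensity g (Iio s) ≤ g s * volume.withDensity g (Iio a) := by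
  have hm := h.qc.measurable
  rw [withDensity_apply _ measurableSet_Iio, withDensity_apply _ measurableSet_Iio,
    ← lintegral_const_mul _ hm, ← lintegral_const_mul _ hm]
  rw [← lintegral_indicator measurableSet_Iio, ← lintegral_indicator measurableSet_Iio,
    ← lintegral_add_right_eq_self _ (s - a)]
  refine lintegral_mono fun t => ?_
  by_cases ht : t < a
  · have h1 : t + (s - a) ∈ Iio s := by simp only [mem_Iio]; linarith
    rw [indicator_of_mem h1, indicator_of_mem (show t ∈ Iio a from ht)]
    have := lc_four h a (s - a) (t - a) (Or.inr ⟨by linarith, by linarith⟩)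
    rw [show a + (s - a) + (t - a) = t + (s - a) by ring, show a + (s - a) = s by ring,
      show a + (t - a) = t by ring] at this
    rw [mul_comm]; exact this
  · have h1 : t + (s - a) ∉ Iio s := by simp only [mem_Iio]; linarith
    rw [indicator_of_notMem h1]; exact bot_le

lemma A_right (ν : Measure ℝ) [IsProbabilityMeasure ν] (a : ℝ) :
    2 * (∫⁻ s in Ioi a, ν (Iio s) ∂ν) + ν (Iio a) * ν (Iio a) ≤ 1 := by
  have m1 : MeasurableSet {p : ℝ × ℝ | a < p.1 ∧ p.2 < p.1} := by
    apply MeasurableSet.inter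
    · exact measurableSet_lt measurable_const measurable_fst
    · exact measurableSet_lt measurable_snd measurable_fst
  have m2 : MeasurableSet {p : ℝ × ℝ | a < p.2 ∧ p.1 < p.2} := by
    apply MeasurableSet.inter
    · exact measurableSet_lt measurable_const measurable_snd
    · exact measurableSet_lt measurable_fst measurable_snd
  have e1 : (ν.prod ν) {p : ℝ × ℝ | a < p.1 ∧ p.2 < p.1} = ∫⁻ s in Ioi a, ν (Iio s) ∂ν := by
    rw [Measure.prod_apply m1, ← lintegral_indicator measurableSet_Ioi]
    congr 1; ext s
    by_cases hs : a < s
    · rw [indicator_of_mem (show s ∈ Ioi a from hs)]; congr 1; ext x; simp [hs]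
    · rw [indicator_of_notMem (show s ∉ Ioi a from hs)]
      convert measure_empty (μ := ν); ext x; simp [hs]
  have e2 : (ν.prod ν) {p : ℝ × ℝ | a < p.2 ∧ p.1 < p.2} = ∫⁻ s in Ioi a, ν (Iio s) ∂ν := by
    rw [Measure.prod_apply_symm m2, ← lintegral_indicator measurableSet_Ioi]
    congr 1; ext s
    by_cases hs : a < s
    · rw [indicator_of_mem (show s ∈ Ioi a from hs)]; congr 1; ext x; simp [hs]
    · rw [indicator_of_notMem (show s ∉ Ioi a from hs)]
      convert measure_empty (μ := ν); ext x; simp [hs]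
  rw [two_mul]
  nth_rw 1 [← e1]
  rw [← e2, ← Measure.prod_prod, ← measure_union _ m2,
    ← measure_union _ (measurableSet_Iio.prod measurableSet_Iio)]
  · exact prob_le_one
  · rw [Set.disjoint_left]
    rintro ⟨x, y⟩ h1 h2
    simp only [mem_union, mem_ofPred_eq, mem_prod, mem_Iio] at h1 h2
    rcases h1 with h1 | h1 <;> linarith [h1.1, h2.1, h2.2]
  · rw [Set.disjoint_left]
    rintro ⟨x, y⟩ h1 h2
    simp only [mem_ofPred_eq] at h1 h2
    linarith [h1.2, h2.2]

lemma A_left (ν : Measure ℝ) [IsProbabilityMeasure ν] (a : ℝ) :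
    2 * (∫⁻ s in Iio a, ν (Ioi s) ∂ν) + ν (Ioi a) * ν (Ioi a) ≤ 1 := by
  have m1 : MeasurableSet {p : ℝ × ℝ | p.1 < a ∧ p.1 < p.2} := by
    apply MeasurableSet.inter
    · exact measurableSet_lt measurable_fst measurable_const
    · exact measurableSet_lt measurable_fst measurable_snd
  have m2 : MeasurableSet {p : ℝ × ℝ | p.2 < a ∧ p.2 < p.1} := by
    apply MeasurableSet.inter
    · exact measurableSet_lt measurable_snd measurable_const
    · exact measurableSet_lt measurable_snd measurable_fst
  have e1 : (ν.prod ν) {p : ℝ × ℝ | p.1 < a ∧ p.1 < p.2} = ∫⁻ s in Iio a, ν (Ioi s) ∂ν := by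
    rw [Measure.prod_apply m1, ← lintegral_indicator measurableSet_Iio]
    congr 1; ext s
    by_cases hs : s < a
    · rw [indicator_of_mem (show s ∈ Iio a from hs)]; congr 1; ext x; simp [hs]
    · rw [indicator_of_notMem (show s ∉ Iio a from hs)]
      convert measure_empty (μ := ν); ext x; simp [hs]
  have e2 : (ν.prod ν) {p : ℝ × ℝ | p.2 < a ∧ p.2 < p.1} = ∫⁻ s in Iio a, ν (Ioi s) ∂ν := by
    rw [Measure.prod_apply_symm m2, ← lintegral_indicator measurableSet_Iio]
    congr 1; ext s
    by_cases hs : s < a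
    · rw [indicator_of_mem (show s ∈ Iio a from hs)]; congr 1; ext x; simp [hs]
    · rw [indicator_of_notMem (show s ∉ Iio a from hs)]
      convert measure_empty (μ := ν); ext x; simp [hs]
  rw [two_mul]
  nth_rw 1 [← e1]
  rw [← e2, ← Measure.prod_prod, ← measure_union _ m2,
    ← measure_union _ (measurableSet_Ioi.prod measurableSet_Ioi)]
  · exact prob_le_one
  · rw [Set.disjoint_left]
    rintro ⟨x, y⟩ h1 h2
    simp only [mem_union, mem_ofPred_eq, mem_prod, mem_Ioi] at h1 h2
    rcases h1 with h1 | h1 <;> linarith [h1.1, h2.1, h2.2]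
  · rw [Set.disjoint_left]
    rintro ⟨x, y⟩ h1 h2
    simp only [mem_ofPred_eq] at h1 h2
    linarith [h1.2, h2.2]

lemma meas_F (ν : Measure ℝ) : Measurable fun s => ν (Iio s) :=
  Monotone.measurable fun _ _ hst => measure_mono (Iio_subset_Iio hst)

lemma meas_G (ν : Measure ℝ) : Measurable fun s => ν (Ioi s) :=
  Antitone.measurable fun _ _ hst => measure_mono (Ioi_subset_Ioi hst)

/-- `∫_{t>s} G(t) dt ` bound -/
lemma tail_right {g : ℝ → ℝ≥0∞} (h : LC g) {a s : ℝ} (has : a ≤ s) :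
    g a * ∫⁻ t in Ioi s, volume.withDensity g (Ioi t) ≤
      volume.withDensity g (Ioi a) * volume.withDensity g (Ioi s) := by
  have hm := h.qc.measurable
  rw [← lintegral_const_mul _ (meas_G _)]
  conv_rhs => rw [withDensity_apply _ (measurableSet_Ioi (a := s)), ← lintegral_const_mul _ hm]
  refine setLIntegral_mono' measurableSet_Ioi fun t ht => ?_
  rw [mul_comm _ (g t)]
  exact hazard_right h (has.trans (le_of_lt ht))

lemma tail_left {g : ℝ → ℝ≥0∞} (h : LC g) {a s : ℝ} (has : s ≤ a) :
    g a * ∫⁻ t in Iio s, volume.withDensity g (Iio t) ≤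
      volume.withDensity g (Iio a) * volume.withDensity g (Iio s) := by
  have hm := h.qc.measurable
  rw [← lintegral_const_mul _ (meas_F _)]
  conv_rhs => rw [withDensity_apply _ (measurableSet_Iio (a := s)), ← lintegral_const_mul _ hm]
  refine setLIntegral_mono' measurableSet_Iio fun t ht => ?_
  rw [mul_comm _ (g t)]
  exact hazard_left h ((le_of_lt ht).trans has)

/-- Hoeffding type functional -/
def WW (ν : Measure ℝ) : ℝ≥0∞ := ∫⁻ s, ν (Iio s) * ∫⁻ t in Ioi s, ν (Ioi t)

lemma meas_tail (ν : Measure ℝ) : Measurable fun s => ∫⁻ t in Ioi s, ν (Ioi t) :=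
  Antitone.measurable fun _ _ hst => lintegral_mono_set (Ioi_subset_Ioi hst)

lemma WW_split (ν : Measure ℝ) (a : ℝ) : WW ν ≤
    (∫⁻ s in Ioi a, ν (Iio s) * ∫⁻ t in Ioi s, ν (Ioi t)) +
    (∫⁻ t in Iio a, ν (Ioi t) * ∫⁻ s in Iio t, ν (Iio s)) +
    (∫⁻ s in Iio a, ν (Iio s)) * ∫⁻ t in Ioi a, ν (Ioi t) := by
  have hF := meas_F ν
  have hG := meas_G ν
  have h1 : WW ν = (∫⁻ s in Ioi a, ν (Iio s) * ∫⁻ t in Ioi s, ν (Ioi t)) +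
      ∫⁻ s in Iio a, ν (Iio s) * ∫⁻ t in Ioi s, ν (Ioi t) := by
    rw [WW, ← lintegral_add_compl _ (measurableSet_Ioi (a := a)), compl_Ioi]
    congr 1
    exact setLIntegral_congr Iio_ae_eq_Iic.symm
  rw [h1, add_assoc]
  gcongr
  have h2 : ∀ s ∈ Iio a, ν (Iio s) * ∫⁻ t in Ioi s, ν (Ioi t) ≤
      (∫⁻ t in Iio a, (Ioi s).indicator (fun t => ν (Iio s) * ν (Ioi t)) t) +
        ν (Iio s) * ∫⁻ t in Ioi a, ν (Ioi t) := by
    intro s hs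
    have : ∫⁻ t in Ioi s, ν (Ioi t) = (∫⁻ t in Iio a ∩ Ioi s, ν (Ioi t)) + 
        ∫⁻ t in Ioi a, ν (Ioi t) := by
      rw [← lintegral_inter_add_sdiff _ (Ioi s) (measurableSet_Iio (a := a)), inter_comm]
      congr 1
      refine setLIntegral_congr ?_
      have : Ioi s \ Iio a = Ici a := by
        ext t; simp only [Set.mem_sdiff, mem_Ioi, mem_Iio, not_lt, mem_Ici]
        exact ⟨fun h => h.2, fun h => ⟨lt_of_lt_of_le hs h, h⟩⟩
      rw [this]
      exact Ioi_ae_eq_Ici.symm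
    rw [this, mul_add, setLIntegral_indicator measurableSet_Ioi, lintegral_const_mul _ hG,
      inter_comm]
  refine (setLIntegral_mono' measurableSet_Iio h2).trans ?_
  rw [lintegral_add_right _ (hF.mul_const _), lintegral_mul_const _ hF]
  refine add_le_add ?_ le_rfl
  rw [lintegral_lintegral_swap]
  · refine setLIntegral_mono' measurableSet_Iio fun t ht => ?_
    rw [← lintegral_const_mul _ hF, ← lintegral_indicator measurableSet_Iio,
      ← lintegral_indicator measurableSet_Iio]
    refine lintegral_mono fun s => ?_
    by_cases hst : s < t
    · simp [indicator, hst, mul_comm, lt_trans hst ht]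
    · simp [indicator, hst]
  · have : Measurable fun p : ℝ × ℝ => 
        {p : ℝ × ℝ | p.1 < p.2}.indicator (fun p => ν (Iio p.1) * ν (Ioi p.2)) p := by
      refine Measurable.indicator ?_ (measurableSet_lt measurable_fst measurable_snd)
      exact (hF.comp measurable_fst).mul (hG.comp measurable_snd)
    exact this.aemeasurable

lemma WW_bound {g : ℝ → ℝ≥0∞} (h : LC g) (hg : IsProbabilityMeasure (volume.withDensity g))
    (a : ℝ) : g a * g a * (2 * WW (volume.withDensity g)) ≤ 1 := by
  have hm := h.qc.measurable
  set ν := volume.withDensity g with hν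
  have hF := meas_F ν
  have hG := meas_G ν
  set p := ν (Iio a) with hp
  set q := ν (Ioi a) with hq
  have b1 : g a * g a * (∫⁻ s in Ioi a, ν (Iio s) * ∫⁻ t in Ioi s, ν (Ioi t)) ≤
      q * q * ∫⁻ s in Ioi a, ν (Iio s) ∂ν := by
    rw [hν, setLIntegral_withDensity_eq_setLIntegral_mul _ hm (hν ▸ hF) measurableSet_Ioi, ← hν,
      ← lintegral_const_mul _ (hF.fun_mul (meas_tail ν)), ← lintegral_const_mul _ (hm.mul hF)]
    refine setLIntegral_mono' measurableSet_Ioi fun s hs => ?_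
    have t1 := tail_right h (le_of_lt hs)
    have t2 := hazard_right h (le_of_lt hs)
    rw [← hν] at t1 t2
    calc _ = ν (Iio s) * g a * (g a * ∫⁻ t in Ioi s, ν (Ioi t)) := by ring
      _ ≤ ν (Iio s) * g a * (q * ν (Ioi s)) := by gcongr
      _ = ν (Iio s) * q * (g a * ν (Ioi s)) := by ring
      _ ≤ ν (Iio s) * q * (g s * q) := by gcongr
      _ = _ := by simp only [Pi.mul_apply]; ring
  have b2 : g a * g a * (∫⁻ t in Iio a, ν (Ioi t) * ∫⁻ s in Iio t, ν (Iio s)) ≤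
      p * p * ∫⁻ s in Iio a, ν (Ioi s) ∂ν := by
    have ml : Measurable fun t => ∫⁻ s in Iio t, ν (Iio s) :=
      Monotone.measurable fun _ _ hst => lintegral_mono_set (Iio_subset_Iio hst)
    rw [hν, setLIntegral_withDensity_eq_setLIntegral_mul _ hm (hν ▸ hG) measurableSet_Iio, ← hν,
      ← lintegral_const_mul _ (hG.fun_mul ml), ← lintegral_const_mul _ (hm.mul hG)]
    refine setLIntegral_mono' measurableSet_Iio fun s hs => ?_
    have t1 := tail_left h (le_of_lt hs)
    have t2 := hazard_left h (le_of_lt hs)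
    rw [← hν] at t1 t2
    calc _ = ν (Ioi s) * g a * (g a * ∫⁻ t in Iio s, ν (Iio t)) := by ring
      _ ≤ ν (Ioi s) * g a * (p * ν (Iio s)) := by gcongr
      _ = ν (Ioi s) * p * (g a * ν (Iio s)) := by ring
      _ ≤ ν (Ioi s) * p * (g s * p) := by gcongr
      _ = _ := by simp only [Pi.mul_apply]; ring
  have b3 := tail_right h (le_refl a)
  have b4 := tail_left h (le_refl a)
  rw [← hν] at b3 b4
  have a1 := A_right ν a
  have a2 := A_left ν a
  have hpq : p + q ≤ 1 := by
    rw [hp, hq, ← measure_union _ measurableSet_Ioi]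
    · exact prob_le_one
    · rw [Set.disjoint_left]; intro x hx hx'; exact lt_asymm (mem_Iio.1 hx) (mem_Ioi.1 hx')
  set A := ∫⁻ s in Ioi a, ν (Iio s) ∂ν
  set A' := ∫⁻ s in Iio a, ν (Ioi s) ∂ν
  calc g a * g a * (2 * WW ν) ≤ g a * g a * (2 * (_ + _ + _)) := by
        gcongr; exact WW_split ν a
    _ = 2 * (g a * g a * (∫⁻ s in Ioi a, ν (Iio s) * ∫⁻ t in Ioi s, ν (Ioi t)) + 
        g a * g a * (∫⁻ t in Iio a, ν (Ioi t) * ∫⁻ s in Iio t, ν (Iio s)) +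
        (g a * ∫⁻ s in Iio a, ν (Iio s)) * (g a * ∫⁻ t in Ioi a, ν (Ioi t))) := by ring
    _ ≤ 2 * (q * q * A + p * p * A' + (p * p) * (q * q)) := by gcongr
    _ = q * q * (2 * A + p * p) + p * p * (2 * A' + q * q) := by ring
    _ ≤ q * q * 1 + p * p * 1 := by gcongr
    _ ≤ (q * q * 1 + p * p * 1) + 2 * p * q := le_self_add
    _ = (p + q) * (p + q) := by ring
    _ ≤ 1 * 1 := by gcongr
    _ = 1 := one_mul 1

lemma tail_eq (ν : Measure ℝ) [IsProbabilityMeasure ν] (s : ℝ) :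
    ∫⁻ t in Ioi s, ν (Ioi t) = ∫⁻ y, ENNReal.ofReal (y - s) ∂ν := by
  have m : MeasurableSet {p : ℝ × ℝ | p.1 < p.2} := measurableSet_lt measurable_fst measurable_snd
  have h1 := Measure.prod_apply (μ := volume.restrict (Ioi s)) (ν := ν) m
  have h2 := Measure.prod_apply_symm (μ := volume.restrict (Ioi s)) (ν := ν) m
  rw [h1] at h2
  refine h2.trans ?_
  congr 1
  ext y
  rw [Measure.restrict_apply (measurable_prodMk_right m)]
  have : (fun x => (x, y)) ⁻¹' {p : ℝ × ℝ | p.1 < p.2} ∩ Ioi s = Ioo s y := by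
    ext t; simp [and_comm]
  rw [this, Real.volume_Ioo]

lemma inner_int {x y : ℝ} (hxy : x ≤ y) :
    ENNReal.ofReal ((y - x) ^ 2 / 2) ≤ ∫⁻ s in Ioi x, ENNReal.ofReal (y - s) := by
  refine le_trans ?_ (lintegral_mono_set (show Ioc x y ⊆ Ioi x from Ioc_subset_Ioi_self))
  have hI : IntegrableOn (fun s => y - s) (Ioc x y) :=
    ((continuous_const.sub continuous_id).integrableOn_Icc).mono_set Ioc_subset_Icc_self
  rw [← ofReal_integral_eq_lintegral_ofReal hI]
  · rw [← intervalIntegral.integral_of_le hxy]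
    apply ENNReal.ofReal_le_ofReal
    rw [intervalIntegral.integral_comp_sub_left (fun s => s) y]
    simp
  · filter_upwards [ae_restrict_mem measurableSet_Ioc] with s hs
    simpa using hs.2

lemma WW_eq (ν : Measure ℝ) [IsProbabilityMeasure ν] :
    WW ν = ∫⁻ x, ∫⁻ y, (∫⁻ s in Ioi x, ENNReal.ofReal (y - s)) ∂ν ∂ν := by
  have hsw : ∀ x, ∫⁻ y, (∫⁻ s in Ioi x, ENNReal.ofReal (y - s)) ∂ν
      = ∫⁻ s in Ioi x, ∫⁻ t in Ioi s, ν (Ioi t) := by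
    intro x
    rw [lintegral_lintegral_swap]
    · simp_rw [tail_eq]
    · fun_prop
  simp_rw [hsw]
  have h1 : ∀ x, ∫⁻ s in Ioi x, ∫⁻ t in Ioi s, ν (Ioi t) = 
      ∫⁻ s, (Ioi x).indicator (fun s => ∫⁻ t in Ioi s, ν (Ioi t)) s := fun x => by
    rw [lintegral_indicator measurableSet_Ioi]
  simp_rw [h1]
  rw [lintegral_lintegral_swap]
  · rw [WW]
    congr 1
    ext s
    have : ∀ x, (Ioi x).indicator (fun s => ∫⁻ t in Ioi s, ν (Ioi t)) s = 
        (Iio s).indicator (fun _ => ∫⁻ t in Ioi s, ν (Ioi t)) x := by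
      intro x; simp [indicator]
    simp_rw [this]
    rw [lintegral_indicator_const measurableSet_Iio, mul_comm]
  · have : Measurable fun p : ℝ × ℝ => 
        {p : ℝ × ℝ | p.1 < p.2}.indicator (fun p => ∫⁻ t in Ioi p.2, ν (Ioi t)) p := by
      refine Measurable.indicator ?_ (measurableSet_lt measurable_fst measurable_snd)
      exact (meas_tail ν).comp measurable_snd
    exact this.aemeasurable

lemma WW_lower (ν : Measure ℝ) [IsProbabilityMeasure ν] (hi : Integrable (fun x => x) ν)
    (hi2 : Integrable (fun x => x ^ 2) ν) (h1 : ∫ x, x ∂ν = 0) (h2 : ∫ x, x ^ 2 ∂ν = 1) :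
    1 ≤ 2 * WW ν := by
  set k : ℝ → ℝ → ℝ≥0∞ := fun x y => ENNReal.ofReal ((max (y - x) 0) ^ 2 / 2) with hk
  have km : Measurable (fun p : ℝ × ℝ => k p.1 p.2) := by
    simp only [hk]; fun_prop
  have kx : ∀ x, Measurable (k x) := by
    intro x; simp only [hk]; fun_prop
  have hW : ∫⁻ x, ∫⁻ y, k x y ∂ν ∂ν ≤ WW ν := by
    rw [WW_eq]
    refine lintegral_mono fun x => lintegral_mono fun y => ?_
    rcases le_total x y with h | h
    · simpa [hk, h] using inner_int h
    · simp [hk, h]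
  have hsw : ∫⁻ x, ∫⁻ y, k x y ∂ν ∂ν = ∫⁻ x, ∫⁻ y, k y x ∂ν ∂ν :=
    lintegral_lintegral_swap km.aemeasurable
  have hsum : ∀ x y, k x y + k y x = ENNReal.ofReal ((y - x) ^ 2 / 2) := by
    intro x y
    rcases le_total x y with h | h
    · simp [hk, h]
    · simp only [hk]
      rw [max_eq_right (by linarith), max_eq_left (by linarith)]
      simp only [ne_eq, OfNat.ofNat_ne_zero, not_false_eq_true, zero_pow, zero_div,
        ENNReal.ofReal_zero, zero_add]
      congr 1; ring
  have hin : ∀ x, ∫⁻ y, ENNReal.ofReal ((y - x) ^ 2 / 2) ∂ν = ENNReal.ofReal ((1 + x ^ 2) / 2) := by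
    intro x
    have e : (fun y : ℝ => (y - x) ^ 2 / 2) = fun y => (1 / 2) * y ^ 2 - x * y + x ^ 2 / 2 := by
      ext y; ring
    have i1 : Integrable (fun y : ℝ => (1 / 2) * y ^ 2 - x * y) ν :=
      (hi2.const_mul _).sub (hi.const_mul _)
    rw [← ofReal_integral_eq_lintegral_ofReal]
    · congr 1
      rw [e, integral_add i1 (integrable_const _), integral_sub (hi2.const_mul _) (hi.const_mul _),
        integral_const_mul, integral_const_mul, h1, h2]
      simp; ring
    · rw [e]; exact i1.add (integrable_const _)
    · exact Eventually.of_forall fun y => by positivity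
  have hout : ∫⁻ x, ENNReal.ofReal ((1 + x ^ 2) / 2) ∂ν = 1 := by
    have i1 : Integrable (fun x : ℝ => 1 + x ^ 2) ν := (integrable_const _).add hi2
    rw [← ofReal_integral_eq_lintegral_ofReal (i1.div_const 2)]
    · rw [integral_div, integral_add (integrable_const _) hi2, h2]; simp
    · exact Eventually.of_forall fun y => by positivity
  clear_value k
  calc (1 : ℝ≥0∞) = ∫⁻ x, ∫⁻ y, ENNReal.ofReal ((y - x) ^ 2 / 2) ∂ν ∂ν := by
        simp_rw [hin]; exact hout.symm
    _ = ∫⁻ x, ((∫⁻ y, k x y ∂ν) + ∫⁻ y, k y x ∂ν) ∂ν := by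
        congr 1; ext x
        rw [← lintegral_add_left]
        · simp_rw [hsum]
        · exact kx x
    _ = (∫⁻ x, ∫⁻ y, k x y ∂ν ∂ν) + ∫⁻ x, ∫⁻ y, k y x ∂ν ∂ν :=
        lintegral_add_left (Measurable.lintegral_prod_right' (f := fun p : ℝ × ℝ => k p.1 p.2) km) _
    _ = 2 * ∫⁻ x, ∫⁻ y, k x y ∂ν ∂ν := by rw [← hsw, two_mul]
    _ ≤ _ := by gcongr

lemma density_le_one {g : ℝ → ℝ≥0∞} (h : LC g) (ν : Measure ℝ) [IsProbabilityMeasure ν]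
    (hν : ν = volume.withDensity g) (hi : Integrable (fun x => x) ν)
    (hi2 : Integrable (fun x => x ^ 2) ν) (h1 : ∫ x, x ∂ν = 0) (h2 : ∫ x, x ^ 2 ∂ν = 1) (a : ℝ) :
    g a ≤ 1 := by
  have l := WW_lower ν hi hi2 h1 h2
  have u := WW_bound h (hν ▸ inferInstance) a
  rw [← hν] at u
  by_contra hc
  push Not at hc
  have : 1 < g a * g a := by
    calc (1 : ℝ≥0∞) < g a := hc
      _ ≤ g a * g a := le_mul_of_one_le_left (zero_le) hc.le
  have h3 : g a * g a ≤ 1 := by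
    calc g a * g a = g a * g a * 1 := (mul_one _).symm
      _ ≤ _ := by gcongr
      _ ≤ 1 := u
  exact absurd h3 (not_le.2 this)

lemma lc_of_isLogConcaveFn {n : ℕ} {f : Euc n → ℝ} (hf : IsLogConcaveFn f) :
    LC fun x => ENNReal.ofReal (f x) := by
  intro x y a b ha hb hab
  have hb' : b = 1 - a := by linarith
  simp only
  rw [ENNReal.ofReal_rpow_of_nonneg (hf.1 x) ha.le, ENNReal.ofReal_rpow_of_nonneg (hf.1 y) hb.le,
    ← ENNReal.ofReal_mul (Real.rpow_nonneg (hf.1 x) _), hb']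
  exact ENNReal.ofReal_le_ofReal (hf.2 x y a ha.le (by linarith))

/-- the marginal in a unit direction has a log-concave density -/
lemma marginal_density {m : ℕ} {F : Euc (m + 1) → ℝ≥0∞} (hF : LC F) (ξ : Euc (m + 1))
    (hξ : ‖ξ‖ = 1) :
    ∃ g : ℝ → ℝ≥0∞, LC g ∧
      (volume.withDensity F).map (fun x => ⟪x, ξ⟫) = volume.withDensity g := by
  obtain ⟨b, hb⟩ := Orthonormal.exists_orthonormalBasis_extension_of_card_eq
    (𝕜 := ℝ) (E := Euc (m + 1)) (ι := Fin (m + 1)) (by simp) (v := fun _ => ξ) (s := {0}) (by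
      rw [orthonormal_iff_ite]
      rintro ⟨i, hi⟩ ⟨j, hj⟩
      simp only [mem_singleton_iff] at hi hj
      subst hi; subst hj
      simp [Set.restrict, hξ])
  have hb0 : b 0 = ξ := hb 0 rfl
  let e := (MeasurableEquiv.piFinSuccAbove (fun _ : Fin (m + 1) => ℝ) 0)
  let T : ℝ × (Fin m → ℝ) → Euc (m + 1) := fun p => b.repr.symm (WithLp.toLp 2 (e.symm p))
  have hadd : ∀ (a c : ℝ) (p q : ℝ × (Fin m → ℝ)),
      e.symm (a • p + c • q) = a • e.symm p + c • e.symm q := by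
    intro a c p q
    ext i
    refine Fin.cases ?_ (fun j => ?_) i <;> simp [e, MeasurableEquiv.piFinSuccAbove]
  have hT : ∀ (a c : ℝ) (p q : ℝ × (Fin m → ℝ)), T (a • p + c • q) = a • T p + c • T q := by
    intro a c p q
    simp only [T, hadd, WithLp.toLp_add, WithLp.toLp_smul, map_add, map_smul]
  have hLC : LC (F ∘ T) := by
    intro p q a c ha hc hac
    simp only [Function.comp, hT]
    exact hF _ _ a c ha hc hac
  have mpT : MeasurePreserving T := 
    (b.measurePreserving_repr_symm.comp (PiLp.volume_preserving_toLp (Fin (m + 1)))).comp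
      (volume_preserving_piFinSuccAbove (fun _ : Fin (m + 1) => ℝ) 0).symm
  have hin : ∀ p, ⟪T p, ξ⟫ = p.1 := by
    intro p
    rw [← hb0, real_inner_comm, ← b.repr_apply_apply]
    simp [T, e, MeasurableEquiv.piFinSuccAbove]
  have hAE : AEMeasurable F := hF.qc.aemeasurable volume
  refine ⟨fun t => ∫⁻ y, F (T (t, y)), lc_marg m _ hLC, ?_⟩
  have mi : Measurable fun x : Euc (m + 1) => ⟪x, ξ⟫ := by fun_prop
  ext S hS
  rw [Measure.map_apply mi hS, withDensity_apply _ (mi hS), withDensity_apply _ hS,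
    ← lintegral_indicator (mi hS), ← lintegral_indicator hS]
  rw [← mpT.map_eq, lintegral_map' (by rw [mpT.map_eq]; exact hAE.indicator (mi hS))
    mpT.aemeasurable, Measure.volume_eq_prod, lintegral_prod]
  · congr 1
    ext t
    by_cases ht : t ∈ S
    · simp [indicator, hin, ht]
    · simp [indicator, hin, ht]
  · exact (hAE.indicator (mi hS)).comp_quasiMeasurePreserving mpT.quasiMeasurePreserving

lemma moments {n : ℕ} (μ : Measure (Euc n)) [IsProbabilityMeasure μ]
    (hcent : ∫ x, x ∂μ = 0)
    (hiso : ∀ i j : Fin n, ∫ x, x i * x j ∂μ = if i = j then 1 else 0)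
    (ξ : Euc n) (hξ : ‖ξ‖ = 1) :
    Integrable (fun x => ⟪x, ξ⟫) μ ∧ Integrable (fun x => ⟪x, ξ⟫ ^ 2) μ ∧
    ∫ x, ⟪x, ξ⟫ ∂μ = 0 ∧ ∫ x, ⟪x, ξ⟫ ^ 2 ∂μ = 1 := by
  have hii : ∀ i, Integrable (fun x : Euc n => x i * x i) μ := by
    intro i
    by_contra hc
    have h1 := hiso i i
    rw [integral_undef hc] at h1
    simp at h1
  have hL2 : ∀ i, MemLp (fun x : Euc n => x i) 2 μ := by
    intro i
    rw [memLp_two_iff_integrable_sq (by fun_prop)]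
    simpa [sq] using hii i
  have hij : ∀ i j, Integrable (fun x : Euc n => x i * x j) μ := fun i j =>
    (hL2 i).integrable_mul (hL2 j)
  have hid2 : MemLp (fun x : Euc n => x) 2 μ := by
    rw [memLp_two_iff_integrable_sq_norm (by fun_prop)]
    simp_rw [EuclideanSpace.real_norm_sq_eq]
    exact integrable_finsetSum _ fun i _ => by simpa [sq] using hii i
  have hid : Integrable (fun x : Euc n => x) μ := hid2.integrable (by norm_num)
  have hexp : ∀ x : Euc n, ⟪x, ξ⟫ ^ 2 = ∑ i, ∑ j, ξ i * ξ j * (x i * x j) := by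
    intro x
    rw [PiLp.inner_apply, sq, Finset.sum_mul_sum]
    refine Finset.sum_congr rfl fun i _ => Finset.sum_congr rfl fun j _ => ?_
    simp; ring
  refine ⟨hid.inner_const (𝕜 := ℝ) ξ, ?_, ?_, ?_⟩
  · simp_rw [hexp]
    exact integrable_finsetSum _ fun i _ => integrable_finsetSum _ fun j _ => (hij i j).const_mul _
  · have := integral_inner (𝕜 := ℝ) hid ξ
    rw [hcent, inner_zero_right] at this
    simpa [real_inner_comm] using this
  · simp_rw [hexp]
    rw [integral_finsetSum _ fun i _ => integrable_finsetSum _ fun j _ => (hij i j).const_mul _]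
    have : ∀ i, ∫ x : Euc n, ∑ j, ξ i * ξ j * (x i * x j) ∂μ = ξ i ^ 2 := by
      intro i
      rw [integral_finsetSum _ fun j _ => (hij i j).const_mul _]
      simp_rw [integral_const_mul, hiso]
      simp [sq]
    simp_rw [this]
    rw [← EuclideanSpace.real_norm_sq_eq, hξ, one_pow]

theorem measure_le_minWidth {n : ℕ} (hn : 0 < n)
    (f : Euc n → ℝ) (μ : Measure (Euc n))
    [IsProbabilityMeasure μ]
    (hf : IsLogConcaveFn f)
    (hμ : μ = volume.withDensity (fun x => ENNReal.ofReal (f x)))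
    (hcent : ∫ x, x ∂μ = 0)
    (hiso : ∀ i j : Fin n, ∫ x, x i * x j ∂μ = if i = j then 1 else 0)
    (A : Set (Euc n)) (hA : IsConvexBody A) :
    (μ A).toReal ≤ minWidth A := by
  obtain ⟨m, rfl⟩ : ∃ m, n = m + 1 := ⟨n - 1, by omega⟩
  refine le_csInf ?_ ?_
  · exact ⟨_, EuclideanSpace.single 0 1, by simp, rfl⟩
  rintro w ⟨ξ, hξ, rfl⟩
  obtain ⟨i1, i2, m1, m2⟩ := moments μ hcent hiso ξ hξ
  obtain ⟨g, hg, hν⟩ := marginal_density (lc_of_isLogConcaveFn hf) ξ hξ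
  rw [← hμ] at hν
  have mi : Measurable fun x : Euc (m + 1) => ⟪x, ξ⟫ := by fun_prop
  have hprob : IsProbabilityMeasure (μ.map (fun x => ⟪x, ξ⟫)) :=
    Measure.isProbabilityMeasure_map mi.aemeasurable
  have hle := density_le_one hg _ hν
    ((integrable_map_measure (by fun_prop) mi.aemeasurable).2 i1)
    ((integrable_map_measure (by fun_prop) mi.aemeasurable).2 i2)
    ((integral_map mi.aemeasurable (by fun_prop)).trans m1)
    ((integral_map mi.aemeasurable (by fun_prop)).trans m2)
  obtain ⟨-, hK, hint⟩ := hA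
  have bdd : ∀ η : Euc (m + 1), ∀ x ∈ A, ⟪x, η⟫ ≤ suppFn A η := by
    intro η x hx
    refine le_csSup ?_ ⟨x, hx, rfl⟩
    exact (hK.image (by fun_prop)).bddAbove
  have hsub : A ⊆ (fun x => ⟪x, ξ⟫) ⁻¹' Icc (-suppFn A (-ξ)) (suppFn A ξ) := by
    intro x hx
    have h1 := bdd ξ x hx
    have h2 := bdd (-ξ) x hx
    rw [inner_neg_right] at h2
    exact ⟨by simp only; linarith, h1⟩
  have hnn : 0 ≤ suppFn A ξ + suppFn A (-ξ) := by
    obtain ⟨x, hx⟩ := hint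
    obtain ⟨h1, h2⟩ := hsub (interior_subset hx)
    linarith [h1.trans h2]
  refine ENNReal.toReal_le_of_le_ofReal hnn ?_
  calc μ A ≤ μ ((fun x => ⟪x, ξ⟫) ⁻¹' Icc (-suppFn A (-ξ)) (suppFn A ξ)) := measure_mono hsub
    _ = (μ.map (fun x => ⟪x, ξ⟫)) (Icc (-suppFn A (-ξ)) (suppFn A ξ)) :=
        (Measure.map_apply mi measurableSet_Icc).symm
    _ = ∫⁻ t in Icc (-suppFn A (-ξ)) (suppFn A ξ), g t := by
        rw [hν, withDensity_apply _ measurableSet_Icc]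
    _ ≤ ∫⁻ t in Icc (-suppFn A (-ξ)) (suppFn A ξ), 1 := lintegral_mono fun t => hle t
    _ = _ := by
        rw [setLIntegral_one, Real.volume_Icc, sub_neg_eq_add]
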